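/- arXiv:1512.05422 — 3 statements merged into one kernel-verified Lean document; each statement's English description precedes it below -/
import Mathlib

section
/- With the split and merge maps Δ̃ : A → A' and μ̃ : A' → A as in the context, both are chain maps with respect to the differentials given by left multiplication by ω and ω': for all w ∈ A, Δ̃(ω * w) = ω' * Δ̃(w), and for all w' ∈ A', μ̃(ω' * w') = ω * μ̃(w'). (These are the elementary split and merge cobordism maps on the pointed Khovanov complexes of planar unlinks, shown in the paper to be chain maps.) -/
open scoped TensorProduct

noncomputable section

/-- The exterior algebra over `ℤ` on the free module with basis `P`. -/
abbrev Lam (P : Type) : Type := ExteriorAlgebra ℤ (P →₀ ℤ)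

/-- The generator `y_p` of the exterior algebra. -/
def yGen {P : Type} (p : P) : Lam P := ExteriorAlgebra.ι ℤ (Finsupp.single p 1)

/-- The ideal of squares of variables in `ℤ[x_0, …, x_{k-1}]`. -/
abbrev Bsq (k : ℕ) : Ideal (MvPolynomial (Fin k) ℤ) :=
  Ideal.span (Set.range fun i : Fin k => MvPolynomial.X i ^ 2)

/-- The algebra `B_k = ℤ[x_0, …, x_{k-1}]/(x_0², …, x_{k-1}²)`. -/
abbrev Bk (k : ℕ) : Type := MvPolynomial (Fin k) ℤ ⧸ Bsq k

/-- The class `x_i` of the `i`-th variable in `B_k`. -/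
def xCls {k : ℕ} (i : Fin k) : Bk k := Ideal.Quotient.mk (Bsq k) (MvPolynomial.X i)

/-- `A = Λ ⊗_ℤ B_k`. -/
abbrev Akh (P : Type) (k : ℕ) : Type := Lam P ⊗[ℤ] Bk k

/-- `α_i = Σ_{p : π p = i} y_p`. -/
def alph {P : Type} [Fintype P] {k : ℕ} (π : P → Fin k) (i : Fin k) : Lam P :=
  ∑ p : P, if π p = i then yGen p else 0

/-- `ω = Σ_i α_i ⊗ x_i`. -/
def omegaEl {P : Type} [Fintype P] {k : ℕ} (π : P → Fin k) : Akh P k :=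
  ∑ i : Fin k, alph π i ⊗ₜ[ℤ] xCls i

/-- The contraction (interior product) `y_p^*` on the exterior algebra: the unique
`ℤ`-linear antiderivation sending `y_q` to `1` if `q = p` and to `0` otherwise. -/
def yStar {P : Type} (p : P) : Lam P →ₗ[ℤ] Lam P :=
  CliffordAlgebra.contractLeft (Q := (0 : QuadraticForm ℤ (P →₀ ℤ))) (Finsupp.lapply p)

/-- The extension `y_p^* ⊗ id` of the contraction to `A = Λ ⊗ B_k`. -/
def yStarA {P : Type} (p : P) (k : ℕ) : Akh P k →ₗ[ℤ] Akh P k :=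
  LinearMap.rTensor (Bk k) (yStar p)

/-- The operator `ζ_p : A → A`, `ζ_p(w) = (1 ⊗ x_{π p}) * y_p^*(w)`. -/
def zetaP {P : Type} [Fintype P] {k : ℕ} (π : P → Fin k) (p : P) (w : Akh P k) : Akh P k :=
  ((1 : Lam P) ⊗ₜ[ℤ] xCls (π p)) * yStarA p k w

/-- The `ℤ`-algebra homomorphism `B_k → B_l` induced by a map of variables. -/
def quotMap {k l : ℕ} (f : Fin k → Fin l) : Bk k →ₐ[ℤ] Bk l :=
  Ideal.Quotient.liftₐ (Bsq k)
    ((Ideal.Quotient.mkₐ ℤ (Bsq l)).comp (MvPolynomial.rename f))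
    (by
      intro a ha
      have h : Bsq k ≤ RingHom.ker ((Ideal.Quotient.mkₐ ℤ (Bsq l)).comp
          (MvPolynomial.rename f)) := by
        rw [Ideal.span_le]
        rintro _ ⟨i, rfl⟩
        simp only [SetLike.mem_coe, RingHom.mem_ker, AlgHom.coe_comp, Function.comp_apply,
          map_pow, MvPolynomial.rename_X, Ideal.Quotient.mkₐ_eq_mk]
        exact Ideal.Quotient.eq_zero_iff_mem.mpr (Ideal.subset_span ⟨f i, rfl⟩)
      exact h ha)

/-- The merge map `Fin (k+1) → Fin k`: `0, 1 ↦ 0` and `j ↦ j - 1` for `j ≥ 2`. -/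
def mergeMap {k : ℕ} (hk : 1 ≤ k) : Fin (k + 1) → Fin k :=
  fun j => ⟨j.val - 1, by omega⟩

/-- The variable inclusion `Fin k → Fin (k+1)`: `0 ↦ 0` and `i ↦ i + 1` for `i ≥ 1`. -/
def splitVar {k : ℕ} : Fin k → Fin (k + 1) :=
  fun i => if i.val = 0 then 0 else i.succ

/-- The algebra map `j* : B_k → B_{k+1}`, `x_0 ↦ x_0`, `x_i ↦ x_{i+1}` for `i ≥ 1`. -/
def jStar {k : ℕ} : Bk k →ₐ[ℤ] Bk (k + 1) := quotMap splitVar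

/-- The algebra map `μ : B_{k+1} → B_k`, `x_0, x_1 ↦ x_0`, `x_j ↦ x_{j-1}` for `j ≥ 2`. -/
def muHom {k : ℕ} (hk : 1 ≤ k) : Bk (k + 1) →ₐ[ℤ] Bk k := quotMap (mergeMap hk)

/-- The split map `Δ̃ : A → A'`. -/
def splitTilde {P : Type} {k : ℕ} (w : Akh P k) : Akh P (k + 1) :=
  ((1 : Lam P) ⊗ₜ[ℤ] (xCls 0 + xCls 1)) *
    (TensorProduct.map LinearMap.id jStar.toLinearMap) w

/-- The merge map `μ̃ = id ⊗ μ : A' → A`. -/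
def mergeTilde {P : Type} {k : ℕ} (hk : 1 ≤ k) : Akh P (k + 1) →ₗ[ℤ] Akh P k :=
  TensorProduct.map LinearMap.id (muHom hk).toLinearMap

section TensorAlgebra

variable {R L B B' ι : Type*} [CommRing R] [Ring L] [Algebra R L] [CommRing B] [Algebra R B]
  [CommRing B'] [Algebra R B']

theorem one_tmul_mul_comm (b : B) (w : L ⊗[R] B) :
    ((1 : L) ⊗ₜ[R] b) * w = w * ((1 : L) ⊗ₜ[R] b) := by
  induction w with
  | zero => simp
  | tmul a c => simp [mul_comm]
  | add u v hu hv => rw [mul_add, add_mul, hu, hv]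

theorem map_id_sum_tmul_mul [Fintype ι] (g : B →ₐ[R] B') (y : ι → L) (x : ι → B) (w : L ⊗[R] B) :
    TensorProduct.map LinearMap.id g.toLinearMap ((∑ i, y i ⊗ₜ[R] x i) * w) =
      (∑ i, y i ⊗ₜ[R] g (x i)) * TensorProduct.map LinearMap.id g.toLinearMap w := by
  have h := map_mul (Algebra.TensorProduct.map (AlgHom.id R L) g) (∑ i, y i ⊗ₜ[R] x i) w
  rw [map_sum] at h
  exact h

theorem one_tmul_mul_map_id_sum_tmul_mul [Fintype ι] (g : B →ₐ[R] B') (c : B') (y : ι → L)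
    (x : ι → B) (x' : ι → B') (hx : ∀ i, c * g (x i) = c * x' i) (w : L ⊗[R] B) :
    ((1 : L) ⊗ₜ[R] c) *
        TensorProduct.map LinearMap.id g.toLinearMap ((∑ i, y i ⊗ₜ[R] x i) * w) =
      (∑ i, y i ⊗ₜ[R] x' i) *
        (((1 : L) ⊗ₜ[R] c) * TensorProduct.map LinearMap.id g.toLinearMap w) := by
  rw [map_id_sum_tmul_mul, ← mul_assoc, ← mul_assoc, ← one_tmul_mul_comm]
  simp only [Finset.mul_sum, Algebra.TensorProduct.tmul_mul_tmul, hx]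

end TensorAlgebra

theorem xCls_mul_self {k : ℕ} (i : Fin k) : (xCls i : Bk k) * xCls i = 0 := by
  rw [← sq]
  exact Ideal.Quotient.eq_zero_iff_mem.mpr (Ideal.subset_span ⟨i, rfl⟩)

theorem quotMap_xCls {k l : ℕ} (f : Fin k → Fin l) (i : Fin k) :
    quotMap f (xCls i) = xCls (f i) :=
  congrArg (Ideal.Quotient.mk (Bsq l)) (MvPolynomial.rename_X f i)

theorem omegaEl_eq_sum_yGen {P : Type} [Fintype P] {k : ℕ} (π : P → Fin k) :
    omegaEl π = ∑ p : P, yGen p ⊗ₜ[ℤ] xCls (π p) := by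
  simp only [omegaEl, alph, TensorProduct.sum_tmul]
  rw [Finset.sum_comm]
  refine Finset.sum_congr rfl fun p _ => ?_
  rw [Finset.sum_eq_single (π p)]
  · rw [if_pos rfl]
  · intro i _ hi
    rw [if_neg hi.symm, TensorProduct.zero_tmul]
  · simp

theorem splitVar_mergeMap {k : ℕ} (hk : 1 ≤ k) {j : Fin (k + 1)} (hj : j ≠ 1) :
    splitVar (mergeMap hk j) = j := by
  obtain ⟨n, rfl⟩ := Nat.exists_eq_add_of_le' hk
  cases j using Fin.cases with
  | zero => rfl
  | succ i =>
    have hi : i.val ≠ 0 := fun h => hj (by rw [Fin.val_eq_zero_iff.mp h]; rfl)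
    exact if_neg hi

theorem xCls_zero_add_one_mul {k : ℕ} (hk : 1 ≤ k) (j : Fin (k + 1)) :
    (xCls 0 + xCls 1 : Bk (k + 1)) * xCls (splitVar (mergeMap hk j)) =
      (xCls 0 + xCls 1) * xCls j := by
  obtain ⟨n, rfl⟩ := Nat.exists_eq_add_of_le' hk
  by_cases hj : j = 1
  · subst hj
    have h_one : splitVar (mergeMap hk (1 : Fin (n + 2))) = 0 := rfl
    rw [h_one, add_mul, add_mul, xCls_mul_self, xCls_mul_self, zero_add, add_zero, mul_comm]
  · rw [splitVar_mergeMap hk hj]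

/-- the split map `Δ̃ : A → A'` and the merge map `μ̃ : A' → A` are chain
maps with respect to the differentials given by left multiplication by `ω` and `ω'`. -/
theorem split_merge_are_chain_maps (P : Type) [Fintype P] [Nonempty P] (k : ℕ)
    (hk : 1 ≤ k) (π' : P → Fin (k + 1)) (hπ' : Function.Surjective π') :
    (∀ w : Akh P k,
        splitTilde (omegaEl (mergeMap hk ∘ π') * w) = omegaEl π' * splitTilde w) ∧
      (∀ w' : Akh P (k + 1),
        mergeTilde hk (omegaEl π' * w') = omegaEl (mergeMap hk ∘ π') * mergeTilde hk w') := by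
  refine ⟨fun w => ?_, fun w' => ?_⟩
  · rw [omegaEl_eq_sum_yGen, omegaEl_eq_sum_yGen]
    exact one_tmul_mul_map_id_sum_tmul_mul jStar (xCls 0 + xCls 1) yGen _ _
      (fun p => by
        rw [jStar, quotMap_xCls]
        exact xCls_zero_add_one_mul hk (π' p)) w
  · rw [omegaEl_eq_sum_yGen, omegaEl_eq_sum_yGen]
    refine (map_id_sum_tmul_mul (muHom hk) yGen _ w').trans ?_
    simp only [muHom, quotMap_xCls]
    rfl
end
end

section
/- With notation as in the context, let p ∈ P with π'(p) = 0 and q ∈ P with π'(q) = 1, and define ζ'_r : A' → A' by ζ'_r(w) = (1 ⊗ x_{π'(r)}) * y_r^*(w) for r ∈ P. Then the following identity holds in A': Δ̃((α_0 * α_1 * ⋯ * α_{k−1}) ⊗ 1) = ζ'_p((α'_0 * α'_1 * ⋯ * α'_k) ⊗ 1) − ζ'_q((α'_0 * α'_1 * ⋯ * α'_k) ⊗ 1) + ω' * ((α'_2 * ⋯ * α'_k) ⊗ 1), where products over index sets are taken in the natural order. (This is the key computation in the paper's Proposition determining the split edge map on the Khovanov homology of pointed unlinks: on homology, Δ̃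 sends the generator 1 to (γ'_0 − γ'_1)·1.) -/
open scoped TensorProduct

noncomputable section

section Alph

variable {P : Type} [Fintype P] {k : ℕ} (π : P → Fin k)

/-- The vector of the free module underlying `α_i`. -/
def alphVec (i : Fin k) : P →₀ ℤ := ∑ p : P, if π p = i then Finsupp.single p 1 else 0

theorem alph_eq_ι (i : Fin k) : alph π i = ExteriorAlgebra.ι ℤ (alphVec π i) := by
  simp only [alph, alphVec, map_sum, yGen]
  exact Finset.sum_congr rfl fun p _ => by split_ifs <;> simp

theorem alphVec_apply (i : Fin k) (r : P) : alphVec π i r = if π r = i then 1 else 0 := by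
  rw [alphVec, Finsupp.finsetSum_apply, Finset.sum_eq_single r]
  · split_ifs <;> simp
  · intro b _ hb
    split_ifs <;> simp [hb]
  · simp

theorem yStar_alph_mul (i : Fin k) (r : P) (w : Lam P) :
    yStar r (alph π i * w) = (if π r = i then w else 0) - alph π i * yStar r w := by
  rw [alph_eq_ι]
  refine (CliffordAlgebra.contractLeft_ι_mul (Q := (0 : QuadraticForm ℤ (P →₀ ℤ)))
    (Finsupp.lapply r) (alphVec π i) w).trans ?_
  rw [Finsupp.lapply_apply, alphVec_apply]
  split_ifs <;> simp [yStar, ExteriorAlgebra.ι]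

theorem yStar_prod_alph_eq_zero (r : P) (l : List (Fin k)) (h : π r ∉ l) :
    yStar r (l.map (alph π)).prod = 0 := by
  induction l with
  | nil => exact CliffordAlgebra.contractLeft_one (Q := (0 : QuadraticForm ℤ (P →₀ ℤ))) _
  | cons i l ih =>
    rw [List.mem_cons, not_or] at h
    rw [List.map_cons, List.prod_cons, yStar_alph_mul, if_neg h.1, ih h.2]
    simp

theorem alph_mul_prod_ofFn {n : ℕ} (f : Fin n → Fin k) (i : Fin n) :
    alph π (f i) * (List.ofFn fun j => alph π (f j)).prod = 0 := by
  simp only [alph_eq_ι]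
  exact ExteriorAlgebra.ι_mul_prod_list (fun j => alphVec π (f j)) i

theorem zetaP_tmul_one (r : P) (w : Lam P) :
    zetaP π r (w ⊗ₜ[ℤ] (1 : Bk k)) = yStar r w ⊗ₜ[ℤ] xCls (π r) := by
  have h : yStarA r k (w ⊗ₜ[ℤ] (1 : Bk k)) = yStar r w ⊗ₜ[ℤ] (1 : Bk k) :=
    LinearMap.rTensor_tmul _ _ _ _
  rw [zetaP, h, Algebra.TensorProduct.tmul_mul_tmul, one_mul, mul_one]

end Alph

section Merge

variable {P : Type} [Fintype P] {n : ℕ} (π' : P → Fin (n + 2))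

theorem alph_merge_zero (hk : 1 ≤ n + 1) :
    alph (mergeMap hk ∘ π') 0 = alph π' 0 + alph π' 1 := by
  simp only [alph, ← Finset.sum_add_distrib]
  refine Finset.sum_congr rfl fun p _ => ?_
  have h0 : (mergeMap hk ∘ π') p = 0 ↔ π' p = 0 ∨ π' p = 1 := by
    simp only [mergeMap, Function.comp_apply, Fin.ext_iff, Fin.val_zero, Fin.val_one]
    omega
  simp only [h0]
  by_cases h : π' p = 0 <;> simp [h]

theorem alph_merge_succ (hk : 1 ≤ n + 1) (i : Fin n) :
    alph (mergeMap hk ∘ π') i.succ = alph π' i.succ.succ := by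
  refine Finset.sum_congr rfl fun p _ => ?_
  have h : (mergeMap hk ∘ π') p = i.succ ↔ π' p = i.succ.succ := by
    simp only [mergeMap, Function.comp_apply, Fin.ext_iff, Fin.val_succ]
    omega
  simp only [h]

theorem yStar_tail_eq_zero (r : P) (h : ∀ i : Fin n, π' r ≠ i.succ.succ) :
    yStar r (List.ofFn fun i : Fin n => alph π' i.succ.succ).prod = 0 := by
  have := yStar_prod_alph_eq_zero π' r (List.ofFn fun i : Fin n => i.succ.succ)
    (by simpa [List.mem_ofFn] using fun i => (h i).symm)
  rwa [List.map_ofFn] at this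

theorem omegaEl_mul_tail :
    omegaEl π' * ((List.ofFn fun i : Fin n => alph π' i.succ.succ).prod ⊗ₜ[ℤ]
        (1 : Bk (n + 2))) =
      (alph π' 0 * (List.ofFn fun i : Fin n => alph π' i.succ.succ).prod) ⊗ₜ[ℤ] xCls 0 +
      (alph π' 1 * (List.ofFn fun i : Fin n => alph π' i.succ.succ).prod) ⊗ₜ[ℤ] xCls 1 := by
  have h := Finset.sum_mul Finset.univ (fun i => alph π' i ⊗ₜ[ℤ] (xCls i : Bk (n + 2)))
    ((List.ofFn fun i : Fin n => alph π' i.succ.succ).prod ⊗ₜ[ℤ] (1 : Bk (n + 2)))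
  refine h.trans ?_
  rw [Fin.sum_univ_succ, Fin.sum_univ_succ, Finset.sum_eq_zero]
  · simp [Algebra.TensorProduct.tmul_mul_tmul]
  · intro i _
    rw [Algebra.TensorProduct.tmul_mul_tmul,
      alph_mul_prod_ofFn π' (fun i : Fin n => i.succ.succ) i, TensorProduct.zero_tmul]

end Merge

/-- the split map on the generator.  With `p, q ∈ P` satisfying
`π' p = 0`, `π' q = 1`,
`Δ̃((α_0 ⋯ α_{k-1}) ⊗ 1) = ζ'_p((α'_0 ⋯ α'_k) ⊗ 1) - ζ'_q((α'_0 ⋯ α'_k) ⊗ 1)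
  + ω' * ((α'_2 ⋯ α'_k) ⊗ 1)`. -/
theorem split_map_on_generator (P : Type) [Fintype P] [Nonempty P] (k : ℕ)
    (hk : 1 ≤ k) (π' : P → Fin (k + 1)) (hπ' : Function.Surjective π')
    (p q : P) (hp : π' p = 0) (hq : π' q = 1) :
    splitTilde ((List.ofFn fun i : Fin k => alph (mergeMap hk ∘ π') i).prod ⊗ₜ[ℤ]
        (1 : Bk k)) =
      zetaP π' p ((List.ofFn fun j : Fin (k + 1) => alph π' j).prod ⊗ₜ[ℤ] (1 : Bk (k + 1)))
        - zetaP π' q ((List.ofFn fun j : Fin (k + 1) => alph π' j).prod ⊗ₜ[ℤ]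
            (1 : Bk (k + 1)))
        + omegaEl π' *
            (((List.ofFn fun j : Fin (k + 1) => alph π' j).drop 2).prod ⊗ₜ[ℤ]
              (1 : Bk (k + 1))) := by
  obtain ⟨n, rfl⟩ : ∃ n, k = n + 1 := ⟨k - 1, by omega⟩
  rw [List.ofFn_succ, List.ofFn_succ, List.ofFn_succ, List.drop_succ_cons, List.drop_succ_cons,
    List.drop_zero, omegaEl_mul_tail, alph_merge_zero]
  simp only [alph_merge_succ, List.prod_cons, Fin.succ_zero_eq_one]
  have hp' : yStar p (List.ofFn fun i : Fin n => alph π' i.succ.succ).prod = 0 :=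
    yStar_tail_eq_zero π' p fun i => by simp [hp, Fin.ext_iff]
  have hq' : yStar q (List.ofFn fun i : Fin n => alph π' i.succ.succ).prod = 0 :=
    yStar_tail_eq_zero π' q fun i => by simp [hq, Fin.ext_iff]
  simp only [splitTilde, zetaP_tmul_one, TensorProduct.map_tmul,
    LinearMap.id_apply, AlgHom.toLinearMap_apply, map_one, yStar_alph_mul, hp, hq, hp', hq',
    Algebra.TensorProduct.tmul_mul_tmul, one_mul, mul_one]
  simp [TensorProduct.add_tmul, TensorProduct.tmul_add, add_mul, TensorProduct.neg_tmul]
  abel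
end
end

section
/- With notation as in the context, the merge map satisfies the identity μ̃((α'_0 * α'_1 * α'_2 * ⋯ * α'_k) ⊗ 1) = (α'_0 ⊗ 1) * ((α_0 * α_1 * ⋯ * α_{k−1}) ⊗ 1) in A, where products over index sets are taken in the natural order. (This is the generator computation in the paper's Proposition determining the merge edge map on the Khovanov homology of pointed unlinks: on homology, μ̃ sends the generator 1 to α'_0 · 1.) -/
open scoped TensorProduct

noncomputable section

/-- `α_i` is the image of the indicator vector of the fibre of `π` over `i`. -/
theorem alph_eq_ι_s13 {P : Type} [Fintype P] {k : ℕ} (π : P → Fin k) (i : Fin k) :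
    alph π i = ExteriorAlgebra.ι ℤ (∑ p : P, if π p = i then Finsupp.single p 1 else 0) := by
  simp only [alph, yGen, map_sum, apply_ite (ExteriorAlgebra.ι ℤ), map_zero]

theorem alph_mul_self {P : Type} [Fintype P] {k : ℕ} (π : P → Fin k) (i : Fin k) :
    alph π i * alph π i = 0 := by
  rw [alph_eq_ι_s13, ExteriorAlgebra.ι_sq_zero]

/-- Merging the first two fibres adds their generators. -/
theorem alph_mergeMap_zero {P : Type} [Fintype P] {n : ℕ} (hn : 1 ≤ n + 1)
    (π : P → Fin (n + 2)) :
    alph (mergeMap hn ∘ π) 0 = alph π 0 + alph π 1 := by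
  simp only [alph, ← Finset.sum_add_distrib]
  refine Finset.sum_congr rfl fun p _ => ?_
  have h : (π p).val - 1 = 0 ↔ (π p).val = 0 ∨ (π p).val = 1 := by omega
  simp only [Function.comp_apply, mergeMap, Fin.ext_iff, Fin.val_zero, Fin.val_one, h]
  by_cases h0 : (π p).val = 0 <;> simp [h0]

/-- Merging the first two fibres does not change the other generators. -/
theorem alph_mergeMap_succ {P : Type} [Fintype P] {n : ℕ} (hn : 1 ≤ n + 1)
    (π : P → Fin (n + 2)) (i : Fin n) :
    alph (mergeMap hn ∘ π) i.succ = alph π i.succ.succ := by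
  refine Finset.sum_congr rfl fun p _ => ?_
  congr 1
  simp only [Function.comp_apply, mergeMap, Fin.ext_iff, Fin.val_succ, eq_iff_iff]
  omega

theorem mergeTilde_tmul {P : Type} {k : ℕ} (hk : 1 ≤ k) (a : Lam P) (b : Bk (k + 1)) :
    mergeTilde hk (a ⊗ₜ[ℤ] b) = a ⊗ₜ[ℤ] muHom hk b := rfl

/-- the merge map on the generator:
`μ̃((α'_0 α'_1 ⋯ α'_k) ⊗ 1) = (α'_0 ⊗ 1) * ((α_0 ⋯ α_{k-1}) ⊗ 1)` in `A`. -/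
theorem merge_map_on_generator (P : Type) [Fintype P] [Nonempty P] (k : ℕ)
    (hk : 1 ≤ k) (π' : P → Fin (k + 1)) (hπ' : Function.Surjective π') :
    mergeTilde hk
        ((List.ofFn fun j : Fin (k + 1) => alph π' j).prod ⊗ₜ[ℤ] (1 : Bk (k + 1))) =
      (alph π' 0 ⊗ₜ[ℤ] (1 : Bk k)) *
        ((List.ofFn fun i : Fin k => alph (mergeMap hk ∘ π') i).prod ⊗ₜ[ℤ] (1 : Bk k)) := by
  obtain ⟨n, rfl⟩ := Nat.exists_eq_add_of_le' hk
  have h_prod : (List.ofFn fun j : Fin (n + 2) => alph π' j).prod =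
      alph π' 0 * (List.ofFn fun i : Fin (n + 1) => alph (mergeMap hk ∘ π') i).prod := by
    simp only [List.ofFn_succ, List.prod_cons, alph_mergeMap_zero, alph_mergeMap_succ,
      Fin.succ_zero_eq_one]
    rw [add_mul, mul_add, ← mul_assoc (alph π' 0) (alph π' 0), alph_mul_self, zero_mul, zero_add]
  rw [mergeTilde_tmul, map_one, h_prod, Algebra.TensorProduct.tmul_mul_tmul, one_mul]
end
end
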